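/- Let λ = (λ_1 ≥ ⋯ ≥ λ_r > 0) be a partition of length r ≤ n and define the Grothendieck polynomial G_λ(x_n) := Σ_{w∈C(r,n)} w·( ∏_{i=1}^{r} x_i^{λ_i−i+n} · ∏_{i=1}^{r} ∏_{j=i+1}^{n} (1 + βx_j)/(x_i − x_j) ). Then G_λ(x_n) = [u_1^{−λ_1}⋯u_r^{−λ_r}]( ∏_{i=1}^{r} ( (1/(1+βu_i)) · ∏_{j=1}^{n} (1+βx_j) u_i/(u_i − x_j) ) · ∏_{1≤i<j≤r} (u_j ⊖ u_i)/u_j ), the coefficient being taken in Λ[[β]]. This is the multiplicative (K-theoretic) specialization of the generating-function theorem for the universal Schur functions of Kempf–Laksov type. -/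

import Mathlib

open Finset

noncomputable section

instance finWF (r : ℕ) : WellFoundedLT (Fin r) :=
  inferInstanceAs (IsWellFounded (Fin r) (· < ·))

/-- The field `ℚ(x_1, …, x_n)` of rational functions. -/
abbrev K (n : ℕ) : Type := FractionRing (MvPolynomial (Fin n) ℚ)

/-- The indeterminate `x_i` (`0`-indexed). -/
def x (n : ℕ) (i : Fin n) : K n :=
  algebraMap (MvPolynomial (Fin n) ℚ) (K n) (MvPolynomial.X i)

/-- The coset representatives `C(r,n)`. -/
def Cperm (r n : ℕ) : Finset (Equiv.Perm (Fin n)) :=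
  Finset.univ.filter fun w => ∀ i j : Fin n, r ≤ (i : ℕ) → i < j → w i < w j

/-- The ring `Λ[[β]]`, where `Λ = K((u_1⁻¹))⋯((u_r⁻¹))`, realized inside the Hahn series
field over the lexicographically ordered group `ℤ^{r+1}` (coordinate `0` is the exponent of
the power series variable `β` and is the most significant). -/
abbrev H (n r : ℕ) := HahnSeries (Lex (Fin (r + 1) → ℤ)) (K n)

/-- The formal power series variable `β`. -/
def β (n r : ℕ) : H n r :=
  HahnSeries.single (toLex (Pi.single (0 : Fin (r + 1)) (1 : ℤ))) 1

/-- The variable `u_i` (`0`-indexed). -/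
def u (n r : ℕ) (i : Fin r) : H n r :=
  HahnSeries.single (toLex (Pi.single (Fin.succ (Fin.rev i)) (-1 : ℤ))) 1

/-- The exponent-vector of `β^d · u_1^{−g(1)} ⋯ u_r^{−g(r)}`. -/
def eVec (r : ℕ) (d : ℤ) (g : Fin r → ℤ) : Lex (Fin (r + 1) → ℤ) :=
  toLex (Fin.cases d (fun j => g (Fin.rev j)))

/-- The image of a rational function in the Hahn field. -/
abbrev CK {n r : ℕ} (a : K n) : H n r := HahnSeries.C a

/-- The subring of series whose exponents all lie in the additive submonoid `M`. -/
def supportedIn {n r : ℕ} (M : AddSubmonoid (Lex (Fin (r + 1) → ℤ))) : Subring (H n r) where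
  carrier := {F | ∀ g, F.coeff g ≠ 0 → g ∈ M}
  zero_mem' := fun g hg => absurd HahnSeries.coeff_zero hg
  one_mem' := by
    intro g hg
    have : g ∈ (1 : H n r).support := hg
    rw [HahnSeries.support_one] at this
    rw [Set.mem_singleton_iff.mp this]
    exact M.zero_mem
  add_mem' := by
    intro a b ha hb g hg
    by_cases h : a.coeff g = 0
    · exact hb g fun h' => hg (by rw [HahnSeries.coeff_add, h, h', add_zero])
    · exact ha g h
  neg_mem' := by
    intro a ha g hg
    exact ha g fun h => hg (by rw [HahnSeries.coeff_neg, h, neg_zero])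
  mul_mem' := by
    intro a b ha hb g hg
    obtain ⟨p, hp, q, hq, rfl⟩ := Set.mem_add.mp (HahnSeries.support_mul_subset (x := a) (y := b) hg)
    exact M.add_mem (ha p hp) (hb q hq)

section supportedIn

variable {n r : ℕ} {M : AddSubmonoid (Lex (Fin (r + 1) → ℤ))}

theorem single_mem_supportedIn {a : Lex (Fin (r + 1) → ℤ)} (ha : a ∈ M) (c : K n) :
    (HahnSeries.single a c : H n r) ∈ supportedIn M := by
  intro g hg
  by_cases h : g = a
  · exact h ▸ ha
  · exact absurd (HahnSeries.coeff_single_of_ne h) hg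

theorem CK_mem_supportedIn (c : K n) : (CK c : H n r) ∈ supportedIn M :=
  single_mem_supportedIn M.zero_mem c

theorem inv_one_sub_mem_supportedIn {y : H n r} (hy : y ∈ supportedIn M) (hpos : 0 < y.orderTop) :
    (1 - y)⁻¹ ∈ supportedIn M := by
  have h := HahnSeries.SummableFamily.one_sub_self_mul_hsum_powers hpos
  rw [inv_eq_of_mul_eq_one_right h]
  intro g hg
  obtain ⟨k, hk⟩ := Set.mem_iUnion.mp (HahnSeries.SummableFamily.support_hsum_subset hg)
  rw [HahnSeries.SummableFamily.powers_of_orderTop_pos hpos] at hk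
  exact pow_mem hy k g hk

theorem orderTop_single_pos {a : Lex (Fin (r + 1) → ℤ)} (ha : 0 < a) (c : K n) :
    0 < (HahnSeries.single a c : H n r).orderTop :=
  lt_of_lt_of_le (WithTop.coe_pos.mpr ha) HahnSeries.orderTop_single_le

end supportedIn

section exponents

variable {r : ℕ}

/-- Exponents with no positive entry in the coordinates indexed by `s`. -/
def nonposCone (s : Set (Fin r)) : AddSubmonoid (Lex (Fin (r + 1) → ℤ)) where
  carrier := {g | ∀ i ∈ s, g i.succ ≤ 0}
  zero_mem' := fun _ _ => le_rfl
  add_mem' := fun ha hb i hi => add_nonpos (ha i hi) (hb i hi)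

/-- Exponents with no negative entry outside the leading coordinate. -/
def nonnegCone (r : ℕ) : AddSubmonoid (Lex (Fin (r + 1) → ℤ)) where
  carrier := {g | ∀ i : Fin r, 0 ≤ g i.succ}
  zero_mem' := fun _ => le_rfl
  add_mem' := fun ha hb i => add_nonneg (ha i) (hb i)

/-- Exponents concentrated in the leading coordinate. -/
def leadingAxis (r : ℕ) : AddSubmonoid (Lex (Fin (r + 1) → ℤ)) where
  carrier := {g | ∀ i : Fin r, g i.succ = 0}
  zero_mem' := fun _ => rfl
  add_mem' := fun ha hb i => by
    exact (congrArg₂ (· + ·) (ha i) (hb i)).trans (add_zero 0)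

theorem eVec_succ (d : ℤ) (g : Fin r → ℤ) (i : Fin r) : eVec r d g i.succ = g i.rev := rfl

theorem eVec_add (d e : ℤ) (f g : Fin r → ℤ) :
    eVec r d f + eVec r e g = eVec r (d + e) (f + g) := by
  funext i
  refine Fin.cases ?_ (fun j => ?_) i <;> rfl

theorem eq_eVec_of_mem_leadingAxis {g : Lex (Fin (r + 1) → ℤ)} (hg : g ∈ leadingAxis r) :
    g = eVec r (g 0) fun _ => 0 := by
  funext i
  refine Fin.cases rfl (fun j => hg j) i

theorem toLex_single_pos (i : Fin (r + 1)) : (0 : Lex (Fin (r + 1) → ℤ)) < toLex (Pi.single i 1) :=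
  ⟨i, fun _ hj => (Pi.single_eq_of_ne (M := fun _ => ℤ) hj.ne 1).symm,
    lt_of_lt_of_eq zero_lt_one (Pi.single_eq_same (M := fun _ => ℤ) i (1 : ℤ)).symm⟩

end exponents

section generators

variable {n r : ℕ}

theorem u_eq (i : Fin r) : u n r i = HahnSeries.single (eVec r 0 (Pi.single i (-1))) 1 := by
  unfold u
  refine congrArg (fun a => HahnSeries.single a 1) (funext fun j => ?_)
  refine Fin.cases ?_ (fun k => ?_) j
  · simp [eVec, (Fin.succ_ne_zero _).symm]
  · rw [eVec_succ]
    by_cases h : k = i.rev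
    · subst h; simp
    · have : k.rev ≠ i := fun h' => h (by rw [← h', Fin.rev_rev])
      simp [h, this]

theorem prod_u_pow (m : Fin r → ℕ) :
    ∏ i, u n r i ^ m i = HahnSeries.single (eVec r 0 fun i => -(m i : ℤ)) 1 := by
  have key : ∀ s : Finset (Fin r), ∏ i ∈ s, u n r i ^ m i =
      HahnSeries.single (eVec r 0 (∑ i ∈ s, Pi.single i (-(m i : ℤ)))) 1 := by
    intro s
    induction s using Finset.induction_on with
    | empty =>
      have h : eVec r 0 0 = 0 := by
        funext i
        refine Fin.cases rfl (fun j => rfl) i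
      rw [prod_empty, sum_empty, h]
      rfl
    | insert a s ha ih =>
      have h : m a • eVec r 0 (Pi.single a (-1)) = eVec r 0 (Pi.single a (-(m a : ℤ))) := by
        funext i
        refine Fin.cases ?_ (fun j => ?_) i
        · change m a • (0 : ℤ) = 0
          simp
        · change m a • (Pi.single a (-1 : ℤ) : Fin r → ℤ) j.rev = (Pi.single a _ : Fin r → ℤ) j.rev
          by_cases hj : j.rev = a
          · simp [hj]
          · simp [hj]
      rw [prod_insert ha, ih, u_eq, HahnSeries.single_pow, HahnSeries.single_mul_single, h, eVec_add,
        sum_insert ha, one_pow, one_mul, add_zero]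
  rw [key univ, Finset.univ_sum_single]

theorem coeff_mul_prod_u_pow (F : H n r) (m : Fin r → ℕ) (d : ℤ) (g : Fin r → ℤ) :
    (F * ∏ i, u n r i ^ m i).coeff (eVec r d (g - fun i => (m i : ℤ))) = F.coeff (eVec r d g) := by
  have h : eVec r d (g - fun i => (m i : ℤ)) = eVec r d g + eVec r 0 (fun i => -(m i : ℤ)) := by
    rw [eVec_add, add_zero, sub_eq_add_neg]
    rfl
  rw [prod_u_pow, h, HahnSeries.coeff_mul_single_add, mul_one]

theorem u_ne_zero (i : Fin r) : u n r i ≠ 0 := by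
  simp [u]

theorem u_inv (i : Fin r) :
    (u n r i)⁻¹ = HahnSeries.single (toLex (Pi.single (Fin.succ (Fin.rev i)) (1 : ℤ))) 1 := by
  refine inv_eq_of_mul_eq_one_right ?_
  rw [u, HahnSeries.single_mul_single, ← toLex_add, ← Pi.single_add]
  simp

theorem β_eq : β n r = HahnSeries.single (eVec r 1 0) 1 := by
  unfold β
  refine congrArg (fun a => HahnSeries.single a 1) (funext fun j => ?_)
  refine Fin.cases ?_ (fun k => ?_) j
  · simp [eVec]
  · simp [eVec]

theorem β_mem {M : AddSubmonoid (Lex (Fin (r + 1) → ℤ))} (h : eVec r 1 0 ∈ M) :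
    β n r ∈ supportedIn M := by
  rw [β_eq]
  exact single_mem_supportedIn h _

theorem u_mem_nonposCone (i : Fin r) (s : Set (Fin r)) : u n r i ∈ supportedIn (nonposCone s) := by
  rw [u_eq]
  refine single_mem_supportedIn (fun j _ => ?_) _
  rw [eVec_succ]
  by_cases h : j.rev = i
  · simp [h]
  · simp [h]

theorem β_mem_nonposCone (s : Set (Fin r)) : β n r ∈ supportedIn (nonposCone s) :=
  β_mem fun _ _ => le_rfl

theorem β_mem_leadingAxis : β n r ∈ supportedIn (leadingAxis r) :=
  β_mem fun _ => rfl

theorem leadingAxis_le_nonnegCone : leadingAxis r ≤ nonnegCone r :=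
  fun _ hg i => (hg i).ge

theorem leadingAxis_le_nonposCone (s : Set (Fin r)) : leadingAxis r ≤ nonposCone s :=
  fun _ hg i _ => (hg i).le

theorem supportedIn_mono {M N : AddSubmonoid (Lex (Fin (r + 1) → ℤ))} (h : M ≤ N) :
    (supportedIn M : Subring (H n r)) ≤ supportedIn N :=
  fun _ hF g hg => h (hF g hg)

theorem inv_one_add_β_mul_u_mem (i : Fin r) (s : Set (Fin r)) :
    (1 + β n r * u n r i)⁻¹ ∈ supportedIn (nonposCone s) := by
  have h : 1 + β n r * u n r i = 1 - -(β n r * u n r i) := by ring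
  rw [h]
  refine inv_one_sub_mem_supportedIn
    (neg_mem (mul_mem (β_mem_nonposCone s) (u_mem_nonposCone i s))) ?_
  rw [HahnSeries.orderTop_neg, β_eq, u_eq, HahnSeries.single_mul_single, eVec_add]
  exact orderTop_single_pos ⟨0, fun j hj => absurd hj (Fin.not_lt_zero j), zero_lt_one⟩ _

theorem inv_one_add_β_mul_CK_mem (c : K n) :
    (1 + β n r * CK c)⁻¹ ∈ supportedIn (leadingAxis r) := by
  have h : 1 + β n r * CK c = 1 - -(β n r * CK c) := by ring
  rw [h]
  refine inv_one_sub_mem_supportedIn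
    (neg_mem (mul_mem β_mem_leadingAxis (CK_mem_supportedIn c))) ?_
  have h1 : β n r * CK c = HahnSeries.single (toLex (Pi.single (0 : Fin (r + 1)) (1 : ℤ))) c := by
    rw [β, CK, HahnSeries.C_apply, HahnSeries.single_mul_single, add_zero, one_mul]
  rw [HahnSeries.orderTop_neg, h1]
  exact orderTop_single_pos (toLex_single_pos 0) c

theorem inv_mem_and_orderTop_pos (i : Fin r) (c : K n) :
    CK c * (u n r i)⁻¹ ∈ supportedIn (n := n) (nonnegCone r) ∧
      0 < (CK c * (u n r i)⁻¹).orderTop ∧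
      ∀ s : Set (Fin r), i.rev ∉ s → (u n r i)⁻¹ ∈ supportedIn (n := n) (nonposCone s) := by
  have h1 : CK c * (u n r i)⁻¹ =
      HahnSeries.single (toLex (Pi.single (Fin.succ (Fin.rev i)) (1 : ℤ))) c := by
    rw [u_inv, CK, HahnSeries.C_apply, HahnSeries.single_mul_single, zero_add, mul_one]
  refine ⟨?_, ?_, fun s hs => ?_⟩
  · rw [h1]
    refine single_mem_supportedIn (fun j => ?_) _
    change (0 : ℤ) ≤ (Pi.single _ _ : Fin (r + 1) → ℤ) _
    by_cases h : j = i.rev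
    · simp [h]
    · simp [h]
  · rw [h1]
    exact orderTop_single_pos (toLex_single_pos _) c
  · rw [u_inv]
    refine single_mem_supportedIn (fun j hj => ?_) _
    have h : j ≠ i.rev := fun h => hs (h ▸ hj)
    change (Pi.single _ _ : Fin (r + 1) → ℤ) _ ≤ 0
    simp [h]

theorem inv_u_sub_CK (i : Fin r) (c : K n) :
    (u n r i - CK c)⁻¹ = (u n r i)⁻¹ * (1 - CK c * (u n r i)⁻¹)⁻¹ := by
  rw [← mul_inv, mul_sub, mul_one, mul_left_comm, mul_inv_cancel₀ (u_ne_zero i), mul_one]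

theorem inv_u_sub_CK_mem {i k : Fin r} (h : k ≠ i) (c : K n) :
    (u n r k - CK c)⁻¹ ∈ supportedIn (nonposCone {i.rev}) := by
  obtain ⟨-, h2, h3⟩ := inv_mem_and_orderTop_pos (n := n) k c
  have h4 := h3 {i.rev} fun h' => h (Fin.rev_injective h')
  rw [inv_u_sub_CK]
  exact mul_mem h4 (inv_one_sub_mem_supportedIn (mul_mem (CK_mem_supportedIn c) h4) h2)

theorem u_sub_CK_ne_zero (i : Fin r) (c : K n) : u n r i - CK c ≠ 0 := by
  intro h
  have h1 := congrArg (fun F : H n r => F.coeff (toLex (Pi.single (Fin.succ (Fin.rev i)) (-1)))) h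
  have h2 : (toLex (Pi.single (Fin.succ (Fin.rev i)) (-1)) : Lex (Fin (r + 1) → ℤ)) ≠ 0 := by
    intro h'
    have := congrFun h' (Fin.succ (Fin.rev i))
    simp at this
  simp only [HahnSeries.coeff_sub, u, CK, HahnSeries.C_apply, HahnSeries.coeff_single_same,
    HahnSeries.coeff_single_of_ne h2, HahnSeries.coeff_zero] at h1
  simp at h1

end generators

/-- The numerator `∏_i U_i^{e_i} V_i ∏_{j>i} V_i (U_j − U_i)`; in the application `V_i` is the
inverse of `1 + βU_i`. -/
def numerator {A : Type*} [CommRing A] {r : ℕ} (e : Fin r → ℕ) (U V : Fin r → A) : A :=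
  ∏ i, (U i ^ e i * V i * ∏ j ∈ Ioi i, V i * (U j - U i))

theorem map_numerator {A B : Type*} [CommRing A] [CommRing B] (φ : A →+* B) {r : ℕ}
    (e : Fin r → ℕ) (U V : Fin r → A) :
    φ (numerator e U V) = numerator e (fun i => φ (U i)) (fun i => φ (V i)) := by
  simp [numerator, map_prod]

theorem numerator_sub_mem {A : Type*} [CommRing A] {I : Ideal A} {r : ℕ} (e : Fin r → ℕ) (b : A)
    {U U' V V' : Fin r → A} (hU : ∀ i, U i - U' i ∈ I) (hV : ∀ i, V i * (1 + b * U i) = 1)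
    (hV' : ∀ i, V' i * (1 + b * U' i) = 1) : numerator e U V - numerator e U' V' ∈ I := by
  rw [← Ideal.Quotient.eq, map_numerator, map_numerator]
  have hu : ∀ i, Ideal.Quotient.mk I (U i) = Ideal.Quotient.mk I (U' i) := fun i =>
    Ideal.Quotient.eq.mpr (hU i)
  have hv : ∀ i, Ideal.Quotient.mk I (V i) = Ideal.Quotient.mk I (V' i) := by
    intro i
    have h3 := congrArg (Ideal.Quotient.mk I) (hV i)
    have h4 := congrArg (Ideal.Quotient.mk I) (hV' i)
    simp only [map_mul, map_add, map_one, hu] at h3 h4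
    rw [mul_comm] at h4
    exact left_inv_eq_right_inv h3 h4
  simp only [hu, hv]

theorem numerator_eq_zero_of_not_injective {A : Type*} [CommRing A] {r : ℕ} (e : Fin r → ℕ)
    {U : Fin r → A} (V : Fin r → A) (hU : ¬ Function.Injective U) : numerator e U V = 0 := by
  obtain ⟨i, j, hij, hne⟩ := Function.not_injective_iff.mp hU
  wlog hlt : i < j generalizing i j
  · exact this j i hij.symm hne.symm (lt_of_le_of_ne (not_lt.mp hlt) hne.symm)
  refine prod_eq_zero (mem_univ i) ?_
  rw [prod_eq_zero (mem_Ioi.mpr hlt), mul_zero]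
  rw [hij, sub_self, mul_zero]

section residues

variable {n r : ℕ}

/-- The series in `β` and the `u_i` with no negative powers of the `u_i` which are annihilated by
the coefficient of `u_1^{-1}⋯u_r^{-1}` after multiplication by `∏_k 1/(u_k − c_k)` and by any
further such series. -/
def residueIdeal (c : Fin r → K n) :
    Ideal (supportedIn (nonposCone Set.univ) : Subring (H n r)) where
  carrier := {a | ∀ q : (supportedIn (nonposCone Set.univ) : Subring (H n r)), ∀ d : ℤ,
    ((a : H n r) * q * ∏ k, (u n r k - CK (c k))⁻¹).coeff (eVec r d fun _ => 1) = 0}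
  zero_mem' := fun q d => by simp
  add_mem' := fun {a b} ha hb q d => by
    have h := congrArg₂ (· + ·) (ha q d) (hb q d)
    simpa only [Subring.coe_add, add_mul, HahnSeries.coeff_add, add_zero] using h
  smul_mem' := fun p a ha q d => by
    have h := ha (p * q) d
    rw [smul_eq_mul, Subring.coe_mul, mul_comm (p : H n r), mul_assoc (a : H n r)]
    exact h

/-- `u_i` as a series with no negative powers of the variables. -/
def uInt (i : Fin r) : (supportedIn (nonposCone Set.univ) : Subring (H n r)) :=
  ⟨u n r i, u_mem_nonposCone i _⟩

/-- `1/(1+βu_i)` as a series with no negative powers of the variables. -/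
def vInt (i : Fin r) : (supportedIn (nonposCone Set.univ) : Subring (H n r)) :=
  ⟨(1 + β n r * u n r i)⁻¹, inv_one_add_β_mul_u_mem i _⟩

/-- `c` as a series with no negative powers of the variables. -/
def cInt (c : K n) : (supportedIn (nonposCone Set.univ) : Subring (H n r)) :=
  ⟨CK c, CK_mem_supportedIn c⟩

/-- `1/(1+βc)` as a series with no negative powers of the variables. -/
def wInt (c : K n) : (supportedIn (nonposCone Set.univ) : Subring (H n r)) :=
  ⟨(1 + β n r * CK c)⁻¹,
    supportedIn_mono (leadingAxis_le_nonposCone _) (inv_one_add_β_mul_CK_mem c)⟩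

/-- `β` as a series with no negative powers of the variables. -/
def βInt : (supportedIn (nonposCone Set.univ) : Subring (H n r)) :=
  ⟨β n r, β_mem_nonposCone _⟩

theorem uInt_sub_cInt_mem_residueIdeal (c : Fin r → K n) (i : Fin r) :
    uInt i - cInt (c i) ∈ residueIdeal c := by
  intro q d
  have h : ((uInt i - cInt (c i) : (supportedIn (nonposCone Set.univ) : Subring (H n r))) : H n r)
      * q * ∏ k, (u n r k - CK (c k))⁻¹ = q * ∏ k ∈ univ.erase i, (u n r k - CK (c k))⁻¹ := by
    rw [← mul_prod_erase univ _ (mem_univ i)]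
    have h0 := u_sub_CK_ne_zero i (c i)
    change (u n r i - CK (c i)) * _ * _ = _
    field_simp
  rw [h]
  by_contra hne
  have hmem : (q : H n r) * ∏ k ∈ univ.erase i, (u n r k - CK (c k))⁻¹ ∈
      supportedIn (nonposCone {i.rev}) := by
    refine mul_mem (supportedIn_mono
      (show nonposCone Set.univ ≤ nonposCone {i.rev} from fun g hg j _ => hg j (Set.mem_univ j)) q.2)
      (prod_mem fun k hk => inv_u_sub_CK_mem (ne_of_mem_erase hk) _)
  have := hmem _ hne i.rev rfl
  rw [eVec_succ] at this
  exact absurd this (by norm_num)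

theorem one_add_β_mul_u_ne_zero (i : Fin r) : 1 + β n r * u n r i ≠ 0 := by
  intro h
  have h1 : (1 + β n r * u n r i).coeff 0 = 0 := by rw [h, HahnSeries.coeff_zero]
  have h2 : (0 : Lex (Fin (r + 1) → ℤ)) ≠ eVec r (1 + 0) (0 + Pi.single i (-1)) := by
    intro h'
    have := congrFun h' 0
    exact absurd this (by change (0 : ℤ) ≠ 1 + 0; norm_num)
  rw [β_eq, u_eq, HahnSeries.single_mul_single, eVec_add, HahnSeries.coeff_add,
    HahnSeries.coeff_single_of_ne h2, HahnSeries.coeff_one] at h1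
  simp at h1

theorem one_add_β_mul_CK_ne_zero (c : K n) : 1 + β n r * CK c ≠ 0 := by
  intro h
  have h1 : (1 + β n r * CK c).coeff 0 = 0 := by rw [h, HahnSeries.coeff_zero]
  have h2 : (0 : Lex (Fin (r + 1) → ℤ)) ≠ eVec r 1 0 + 0 := by
    intro h'
    have := congrFun h' 0
    exact absurd this (by change (0 : ℤ) ≠ 1 + 0; norm_num)
  rw [β_eq, CK, HahnSeries.C_apply, HahnSeries.single_mul_single, HahnSeries.coeff_add,
    HahnSeries.coeff_single_of_ne h2, HahnSeries.coeff_one] at h1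
  simp at h1

theorem numerator_sub_mem_residueIdeal (e : Fin r → ℕ) (c : Fin r → K n) :
    numerator e uInt vInt - numerator e (fun i => cInt (c i)) (fun i => wInt (c i)) ∈
      residueIdeal c :=
  numerator_sub_mem e βInt (uInt_sub_cInt_mem_residueIdeal c)
    (fun i => Subtype.ext (inv_mul_cancel₀ (one_add_β_mul_u_ne_zero i)))
    (fun i => Subtype.ext (inv_mul_cancel₀ (one_add_β_mul_CK_ne_zero (c i))))

/-- Series with no positive powers of the `u_i` whose part of degree `0` in the `u_i` vanishes. -/
def positiveIdeal (n r : ℕ) : Ideal (supportedIn (nonnegCone r) : Subring (H n r)) where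
  carrier := {a | ∀ d : ℤ, (a : H n r).coeff (eVec r d fun _ => 0) = 0}
  zero_mem' := fun d => by simp
  add_mem' := fun {a b} ha hb d => by
    rw [Subring.coe_add, HahnSeries.coeff_add, ha d, hb d, add_zero]
  smul_mem' := fun p a ha d => by
    rw [smul_eq_mul, Subring.coe_mul, HahnSeries.coeff_mul]
    refine sum_eq_zero fun ij hij => ?_
    obtain ⟨h1, h2, h3⟩ := mem_antidiagonal.mp hij
    have h4 : ij.2 ∈ leadingAxis r := fun i => by
      have h5 : ij.1 i.succ + ij.2 i.succ = 0 := congrFun h3 i.succ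
      have h6 := p.2 _ h1 i
      have h7 := a.2 _ h2 i
      omega
    rw [eq_eVec_of_mem_leadingAxis h4, ha, mul_zero]

theorem coeff_mul_prod_inv {A : H n r} (hA : A ∈ supportedIn (leadingAxis r)) (c : Fin r → K n)
    (d : ℤ) : (A * ∏ k, (u n r k - CK (c k))⁻¹).coeff (eVec r d fun _ => 1) =
      A.coeff (eVec r d fun _ => 0) := by
  let y : Fin r → (supportedIn (nonnegCone r) : Subring (H n r)) := fun k =>
    ⟨_, (inv_mem_and_orderTop_pos k (c k)).1⟩
  let z : Fin r → (supportedIn (nonnegCone r) : Subring (H n r)) := fun k =>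
    ⟨_, inv_one_sub_mem_supportedIn (y k).2 (inv_mem_and_orderTop_pos k (c k)).2.1⟩
  let A' : (supportedIn (nonnegCone r) : Subring (H n r)) :=
    ⟨A, supportedIn_mono leadingAxis_le_nonnegCone hA⟩
  have hy : ∀ k, y k ∈ positiveIdeal n r := by
    intro k d
    change (CK (c k) * (u n r k)⁻¹).coeff _ = 0
    rw [u_inv, CK, HahnSeries.C_apply, HahnSeries.single_mul_single]
    refine HahnSeries.coeff_single_of_ne fun h => ?_
    have h1 := congrFun h k.rev.succ
    have h2 : (0 : ℤ) = 0 + (Pi.single k.rev.succ (1 : ℤ) : Fin (r + 1) → ℤ) k.rev.succ := h1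
    simp at h2
  have hz : ∀ k, Ideal.Quotient.mk (positiveIdeal n r) (z k) = 1 := by
    intro k
    have h1 : z k * (1 - y k) = 1 := by
      refine Subtype.ext (inv_mul_cancel₀ fun h => ?_)
      have h2 : u n r k - CK (c k) = u n r k * (1 - CK (c k) * (u n r k)⁻¹) := by
        rw [mul_sub, mul_one, mul_left_comm, mul_inv_cancel₀ (u_ne_zero k), mul_one]
      exact u_sub_CK_ne_zero k (c k) (by rw [h2, h, mul_zero])
    have h3 := congrArg (Ideal.Quotient.mk (positiveIdeal n r)) h1
    rwa [map_mul, map_sub, Ideal.Quotient.eq_zero_iff_mem.mpr (hy k), map_one, sub_zero,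
      mul_one] at h3
  have hmem : A' * ∏ k, z k - A' ∈ positiveIdeal n r := by
    rw [← Ideal.Quotient.eq, map_mul, map_prod, prod_congr rfl fun k _ => hz k, prod_const_one,
      mul_one]
  have h1 := hmem d
  have h2 : ((A' * ∏ k, z k - A' : (supportedIn (nonnegCone r) : Subring (H n r))) : H n r) =
      A * ∏ k, (1 - CK (c k) * (u n r k)⁻¹)⁻¹ - A := by
    rw [AddSubgroupClass.coe_sub, Subring.coe_mul, SubmonoidClass.coe_finsetProd]
  rw [h2, HahnSeries.coeff_sub, sub_eq_zero] at h1
  rw [← h1, ← coeff_mul_prod_u_pow _ (fun _ => 1)]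
  have h3 : (A * ∏ k, (u n r k - CK (c k))⁻¹) * ∏ k, u n r k ^ 1 =
      A * ∏ k, (1 - CK (c k) * (u n r k)⁻¹)⁻¹ := by
    rw [mul_assoc, ← prod_mul_distrib]
    refine congrArg _ (prod_congr rfl fun k _ => ?_)
    rw [inv_u_sub_CK, pow_one, mul_right_comm, inv_mul_cancel₀ (u_ne_zero k), one_mul]
  rw [h3]
  congr 2

theorem coeff_numerator_mul_prod_inv {A : H n r} (hA : A ∈ supportedIn (leadingAxis r))
    (e : Fin r → ℕ) (c : Fin r → K n) (d : ℤ) :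
    (A * numerator e (u n r) (fun i => (1 + β n r * u n r i)⁻¹) *
        ∏ k, (u n r k - CK (c k))⁻¹).coeff (eVec r d fun _ => 1) =
      (A * numerator e (fun i => CK (c i)) (fun i => (1 + β n r * CK (c i))⁻¹)).coeff
        (eVec r d fun _ => 0) := by
  have hN : numerator e (fun i => CK (c i)) (fun i => (1 + β n r * CK (c i))⁻¹) ∈
      supportedIn (leadingAxis r) :=
    prod_mem fun i _ => mul_mem (mul_mem (pow_mem (CK_mem_supportedIn _) _)
      (inv_one_add_β_mul_CK_mem _)) (prod_mem fun j _ => mul_mem (inv_one_add_β_mul_CK_mem _)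
        (sub_mem (CK_mem_supportedIn _) (CK_mem_supportedIn _)))
  rw [← coeff_mul_prod_inv (mul_mem hA hN) c, ← sub_eq_zero, ← HahnSeries.coeff_sub, ← sub_mul,
    ← mul_sub, mul_comm A]
  have h := numerator_sub_mem_residueIdeal e c
    ⟨A, supportedIn_mono (leadingAxis_le_nonposCone _) hA⟩ d
  rw [AddSubgroupClass.coe_sub] at h
  have h1 := map_numerator (supportedIn (nonposCone Set.univ) : Subring (H n r)).subtype e uInt vInt
  have h2 := map_numerator (supportedIn (nonposCone Set.univ) : Subring (H n r)).subtype e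
    (fun i => cInt (c i)) (fun i => wInt (c i))
  simp only [Subring.subtype_apply] at h1 h2
  rw [h1, h2] at h
  exact h

end residues

section products

theorem prod_Ioi_comm {M : Type*} [CommMonoid M] {r : ℕ} (f : Fin r → Fin r → M) :
    ∏ i, ∏ j ∈ Ioi i, f i j = ∏ j, ∏ i ∈ Iio j, f i j :=
  prod_comm' fun i j => by simp

theorem prod_Iio_castLE {M : Type*} [CommMonoid M] {n r : ℕ} (hrn : r ≤ n) (i : Fin r)
    (f : Fin n → M) :
    ∏ k ∈ Iio (Fin.castLE hrn i), f k = ∏ k ∈ Iio i, f (Fin.castLE hrn k) := by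
  symm
  refine prod_nbij (Fin.castLE hrn) (fun k hk => ?_) (fun _ _ _ _ h => Fin.castLE_injective hrn h)
    (fun k hk => ?_) fun _ _ => rfl
  · simpa using hk
  · have hk' : k < Fin.castLE hrn i := by simpa using hk
    exact ⟨⟨k, lt_trans (show (k : ℕ) < i from hk') i.2⟩, mem_coe.mpr (mem_Iio.mpr hk'), rfl⟩

theorem prod_erase_eq_Iio_mul_Ioi {M : Type*} [CommMonoid M] {n : ℕ} (a : Fin n) (f : Fin n → M) :
    ∏ k ∈ univ.erase a, f k = (∏ k ∈ Iio a, f k) * ∏ k ∈ Ioi a, f k := by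
  have h : (univ.erase a : Finset (Fin n)) = (Iio a).disjUnion (Ioi a)
      (disjoint_left.mpr fun k h1 h2 => lt_asymm (mem_Iio.mp h1) (mem_Ioi.mp h2)) := by
    ext k
    simp [lt_or_lt_iff_ne]
  rw [h, prod_disjUnion]

variable {F : Type*} [Field F] {n r : ℕ}

theorem prod_inv_sub_eq_sum (hn : 0 < n) {v : Fin n → F} (hv : Function.Injective v) {t : F}
    (ht : ∀ j, t ≠ v j) :
    ∏ j, (t - v j)⁻¹ = ∑ j, (∏ k ∈ univ.erase j, (v j - v k)⁻¹) * (t - v j)⁻¹ := by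
  have hne : (univ : Finset (Fin n)).Nonempty := ⟨⟨0, hn⟩, mem_univ _⟩
  have h := Lagrange.eval_interpolate_not_at_node (s := univ) (v := v) (x := t) 1
    fun j _ => ht j
  rw [Lagrange.interpolate_one hv.injOn hne, Polynomial.eval_one, Lagrange.eval_nodal] at h
  rw [prod_inv_distrib]
  refine inv_eq_of_mul_eq_one_right ?_
  rw [h]
  simp [Lagrange.nodalWeight]

theorem residue_eq_summand (hrn : r ≤ n) {y : Fin n → F} (hy : Function.Injective y) (b : F)
    (hb : ∀ k, 1 + b * y k ≠ 0) (e : Fin r → ℕ) :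
    (∏ k, (1 + b * y k)) ^ r *
        (∏ i : Fin r, ∏ k ∈ univ.erase (Fin.castLE hrn i), (y (Fin.castLE hrn i) - y k)⁻¹) *
        numerator e (fun i => y (Fin.castLE hrn i)) (fun i => (1 + b * y (Fin.castLE hrn i))⁻¹) =
      (∏ i : Fin r, y (Fin.castLE hrn i) ^ e i) *
        ∏ i : Fin r, ∏ j ∈ Ioi (Fin.castLE hrn i), (1 + b * y j) / (y (Fin.castLE hrn i) - y j) := by
  have h1 : (∏ k, (1 + b * y k)) ^ r = (∏ i : Fin r, (1 + b * y (Fin.castLE hrn i))) *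
      (∏ i : Fin r, ∏ j ∈ Ioi i, (1 + b * y (Fin.castLE hrn i))) *
      ∏ i : Fin r, ∏ j ∈ Ioi (Fin.castLE hrn i), (1 + b * y j) := by
    rw [prod_Ioi_comm, ← prod_mul_distrib, ← prod_mul_distrib]
    have : ∀ i : Fin r, (1 + b * y (Fin.castLE hrn i)) *
        (∏ k ∈ Iio i, (1 + b * y (Fin.castLE hrn k))) *
        ∏ j ∈ Ioi (Fin.castLE hrn i), (1 + b * y j) = ∏ k, (1 + b * y k) := fun i => by
      rw [← mul_prod_erase univ _ (mem_univ (Fin.castLE hrn i)), prod_erase_eq_Iio_mul_Ioi,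
        prod_Iio_castLE hrn i fun k => 1 + b * y k, mul_assoc]
    simp [this]
  have h2 : (∏ i : Fin r, ∏ k ∈ univ.erase (Fin.castLE hrn i), (y (Fin.castLE hrn i) - y k)⁻¹) =
      (∏ i : Fin r, ∏ j ∈ Ioi i, (y (Fin.castLE hrn j) - y (Fin.castLE hrn i)))⁻¹ *
      (∏ i : Fin r, ∏ j ∈ Ioi (Fin.castLE hrn i), (y (Fin.castLE hrn i) - y j))⁻¹ := by
    simp_rw [prod_erase_eq_Iio_mul_Ioi, prod_mul_distrib, ← prod_inv_distrib]
    rw [prod_Ioi_comm]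
    congr 1
    exact prod_congr rfl fun i _ => prod_Iio_castLE hrn i _
  have hc : ∏ i : Fin r, (1 + b * y (Fin.castLE hrn i)) ≠ 0 := prod_ne_zero_iff.mpr fun i _ => hb _
  have ha : ∏ i : Fin r, ∏ j ∈ Ioi i, (1 + b * y (Fin.castLE hrn i)) ≠ 0 :=
    prod_ne_zero_iff.mpr fun i _ => prod_ne_zero_iff.mpr fun _ _ => hb _
  have hD : ∏ i : Fin r, ∏ j ∈ Ioi i, (y (Fin.castLE hrn j) - y (Fin.castLE hrn i)) ≠ 0 :=
    prod_ne_zero_iff.mpr fun i _ => prod_ne_zero_iff.mpr fun j hj => sub_ne_zero.mpr fun h =>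
      (mem_Ioi.mp hj).ne' (Fin.castLE_injective hrn (hy h))
  rw [h1, h2, numerator]
  simp only [prod_mul_distrib, prod_div_distrib, prod_inv_distrib]
  generalize (∏ i : Fin r, ∏ j ∈ Ioi (Fin.castLE hrn i), (y (Fin.castLE hrn i) - y j)) = D' at *
  field_simp

/-- The coefficient of `∏_i 1/(U_i − X_{f(i)})` in the partial fraction expansion of
`(∏_k (1 + bX_k))^r ∏_i ∏_j 1/(U_i − X_j)`. -/
def residueWeight (X : Fin n → F) (b : F) (f : Fin r → Fin n) : F :=
  (∏ k, (1 + b * X k)) ^ r * ∏ i, ∏ k ∈ univ.erase (f i), (X (f i) - X k)⁻¹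

theorem residueWeight_mul_numerator (hrn : r ≤ n) {X : Fin n → F} (hX : Function.Injective X)
    (b : F) (hb : ∀ k, 1 + b * X k ≠ 0) (e : Fin r → ℕ) (w : Equiv.Perm (Fin n)) :
    residueWeight X b (fun i => w (Fin.castLE hrn i)) *
        numerator e (fun i => X (w (Fin.castLE hrn i)))
          (fun i => (1 + b * X (w (Fin.castLE hrn i)))⁻¹) =
      (∏ i : Fin r, X (w (Fin.castLE hrn i)) ^ e i) *
        ∏ i : Fin r, ∏ j ∈ Ioi (Fin.castLE hrn i),
          (1 + b * X (w j)) / (X (w (Fin.castLE hrn i)) - X (w j)) := by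
  rw [← residue_eq_summand hrn (y := fun k => X (w k)) (hX.comp w.injective) b (fun k => hb _) e,
    residueWeight, Equiv.prod_comp w fun k => 1 + b * X k]
  congr 2
  refine prod_congr rfl fun i _ => ?_
  have h : univ.erase (w (Fin.castLE hrn i)) =
      (univ.erase (Fin.castLE hrn i)).map w.toEmbedding := by
    rw [map_erase, map_univ_equiv]
    rfl
  rw [h, prod_map]
  rfl

theorem mul_prod_inv_sub_eq_sum (hn : 0 < n) {X : Fin n → F} (hX : Function.Injective X)
    {U : Fin r → F} (hU : ∀ i j, U i - X j ≠ 0) (b N : F) :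
    (∏ k, (1 + b * X k)) ^ r * N * ∏ i, ∏ j, (U i - X j)⁻¹ =
      ∑ f : Fin r → Fin n, residueWeight X b f * N * ∏ i, (U i - X (f i))⁻¹ := by
  rw [prod_congr rfl fun i _ => prod_inv_sub_eq_sum hn hX fun j => sub_ne_zero.mp (hU i j),
    prod_univ_sum, Fintype.piFinset_univ, mul_sum]
  refine sum_congr rfl fun f _ => ?_
  rw [prod_mul_distrib, residueWeight]
  ring

theorem generating_function_eq {U : Fin r → F} (hU : ∀ i, U i ≠ 0) (y : Fin n → F) (b : F)
    (hrn : r ≤ n) {lam : Fin r → ℕ} (hpos : ∀ i, 0 < lam i) :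
    ((∏ i, ((1 + b * U i)⁻¹ * ∏ j, (1 + b * y j) * U i / (U i - y j))) *
        ∏ i, ∏ j ∈ Ioi i, ((U j - U i) / (1 + b * U i)) / U j) * ∏ i, U i ^ (lam i - 1) =
      (∏ k, (1 + b * y k)) ^ r *
        numerator (fun i => lam i + (n - 1 - (i : ℕ))) U (fun i => (1 + b * U i)⁻¹) *
        ∏ i, ∏ j, (U i - y j)⁻¹ := by
  have h1 : ∏ i, ∏ j ∈ Ioi i, U j = ∏ i : Fin r, U i ^ (i : ℕ) := by
    rw [prod_Ioi_comm]
    simp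
  have h2 : (∏ i, U i ^ (lam i + (n - 1 - (i : ℕ)))) * ∏ i : Fin r, U i ^ (i : ℕ) =
      (∏ i, U i ^ n) * ∏ i, U i ^ (lam i - 1) := by
    rw [← prod_mul_distrib, ← prod_mul_distrib]
    refine prod_congr rfl fun i _ => ?_
    rw [← pow_add, ← pow_add]
    congr 1
    have := hpos i
    have := i.2
    omega
  have h3 : ∏ i : Fin r, U i ^ (i : ℕ) ≠ 0 := prod_ne_zero_iff.mpr fun i _ => pow_ne_zero _ (hU i)
  simp only [numerator, div_eq_mul_inv, prod_mul_distrib, prod_inv_distrib, h1, prod_const,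
    card_univ, Fintype.card_fin]
  rw [(eq_mul_inv_iff_mul_eq₀ h3).mpr h2]
  ring

end products

section cosets

variable {n r : ℕ}

/-- The increasing enumeration of the complement of the range of `f`. -/
def complEmb {f : Fin r → Fin n} (hf : Function.Injective f) : Fin (n - r) ↪o Fin n :=
  (univ.image f)ᶜ.orderEmbOfFin (by
    rw [card_compl, card_image_of_injective _ hf, card_univ, Fintype.card_fin, Fintype.card_fin])

theorem complEmb_ne {f : Fin r → Fin n} (hf : Function.Injective f) (k : Fin (n - r)) (i : Fin r) :
    complEmb hf k ≠ f i := fun h =>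
  mem_compl.mp (orderEmbOfFin_mem _ _ k) (mem_image.mpr ⟨i, mem_univ i, h.symm⟩)

theorem Cperm_eq_complEmb (hrn : r ≤ n) {w : Equiv.Perm (Fin n)} (hw : w ∈ Cperm r n)
    {f : Fin r → Fin n} (hf : Function.Injective f) (h : ∀ i, w (Fin.castLE hrn i) = f i)
    (k : Fin (n - r)) : w ⟨r + k, by omega⟩ = complEmb hf k := by
  refine congrFun (orderEmbOfFin_unique _ (f := fun k : Fin (n - r) => w ⟨r + k, by omega⟩)
    (fun k => ?_) fun k l hkl => ?_) k
  · simp only [mem_compl, mem_image, mem_univ, true_and, not_exists]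
    intro i hi
    have := congrArg Fin.val (w.injective ((h i).trans hi))
    simp only [Fin.val_castLE] at this
    omega
  · refine (mem_filter.mp hw).2 _ _ (Nat.le_add_right _ _) ?_
    exact Nat.add_lt_add_left hkl r

theorem Cperm_ext (hrn : r ≤ n) {w w' : Equiv.Perm (Fin n)} (hw : w ∈ Cperm r n)
    (hw' : w' ∈ Cperm r n) (h : ∀ i : Fin r, w (Fin.castLE hrn i) = w' (Fin.castLE hrn i)) :
    w = w' := by
  have hf : Function.Injective fun i => w' (Fin.castLE hrn i) :=
    w'.injective.comp (Fin.castLE_injective hrn)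
  ext1 i
  by_cases hi : (i : ℕ) < r
  · exact h ⟨i, hi⟩
  · have h1 := Cperm_eq_complEmb hrn hw hf h ⟨i - r, by omega⟩
    have h2 := Cperm_eq_complEmb hrn hw' hf (fun _ => rfl) ⟨i - r, by omega⟩
    have h3 : (⟨r + (i - r), by omega⟩ : Fin n) = i := Fin.ext (by simp only; omega)
    simp only [h3] at h1 h2
    rw [h1, h2]

theorem exists_Cperm (hrn : r ≤ n) {f : Fin r → Fin n} (hf : Function.Injective f) :
    ∃ w ∈ Cperm r n, ∀ i : Fin r, w (Fin.castLE hrn i) = f i := by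
  let g : Fin n → Fin n := fun i =>
    if h : (i : ℕ) < r then f ⟨i, h⟩ else complEmb hf ⟨i - r, by omega⟩
  have hg : Function.Injective g := by
    intro i j hij
    simp only [g] at hij
    split_ifs at hij with hi hj hj
    · have := congrArg Fin.val (hf hij)
      exact Fin.ext this
    · exact absurd hij.symm (complEmb_ne hf _ _)
    · exact absurd hij (complEmb_ne hf _ _)
    · have := congrArg Fin.val ((complEmb hf).injective hij)
      simp only at this
      exact Fin.ext (by omega)
  refine ⟨Equiv.ofBijective g (Finite.injective_iff_bijective.mp hg),
    mem_filter.mpr ⟨mem_univ _, fun i j hi hij => ?_⟩, fun i => ?_⟩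
  · have hj : ¬ (j : ℕ) < r := by have : (i : ℕ) < j := hij; omega
    simp only [Equiv.ofBijective_apply, g, dif_neg (not_lt.mpr hi), dif_neg hj]
    refine (complEmb hf).strictMono ?_
    have : (i : ℕ) < j := hij
    change (i : ℕ) - r < j - r
    omega
  · simp [g]

theorem sum_Cperm {M : Type*} [AddCommMonoid M] (hrn : r ≤ n) (T : (Fin r → Fin n) → M)
    (hT : ∀ f, ¬ Function.Injective f → T f = 0) :
    ∑ w ∈ Cperm r n, T (fun i => w (Fin.castLE hrn i)) = ∑ f, T f := by
  classical
  rw [← sum_filter_add_sum_filter_not univ (fun f : Fin r → Fin n => Function.Injective f),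
    sum_eq_zero (s := filter _ _) (fun f hf => hT f (mem_filter.mp hf).2), add_zero]
  refine sum_nbij (fun w i => w (Fin.castLE hrn i)) (fun w _ => ?_)
    (fun w hw w' hw' h => Cperm_ext hrn hw hw' (congrFun h)) (fun f hf => ?_) fun _ _ => rfl
  · exact mem_filter.mpr ⟨mem_univ _, w.injective.comp (Fin.castLE_injective hrn)⟩
  · obtain ⟨w, hw, h⟩ := exists_Cperm hrn (mem_filter.mp hf).2
    exact ⟨w, hw, funext h⟩

end cosets

theorem x_injective (n : ℕ) : Function.Injective (x n) :=
  (IsFractionRing.injective _ _).comp (MvPolynomial.X_injective)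

theorem residueWeight_mem_leadingAxis {n r : ℕ} (f : Fin r → Fin n) :
    residueWeight (fun k => (CK (x n k) : H n r)) (β n r) f ∈ supportedIn (leadingAxis r) := by
  refine mul_mem (pow_mem (prod_mem fun k _ => add_mem (one_mem _)
    (mul_mem β_mem_leadingAxis (CK_mem_supportedIn _))) _)
    (prod_mem fun i _ => prod_mem fun k _ => ?_)
  change (CK _ - CK _ : H n r)⁻¹ ∈ _
  rw [CK, CK, ← map_sub, ← map_inv₀]
  exact CK_mem_supportedIn _

/-- **Generating function for the Grothendieck polynomials (multiplicative,
`K`-theoretic specialization of the universal Schur functions of Kempf–Laksov type).**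

For a partition `λ_1 ≥ ⋯ ≥ λ_r > 0` of length `r ≤ n`,
`G_λ(x_n) = Σ_{w∈C(r,n)} w·( ∏_i x_i^{λ_i−i+n} · ∏_i ∏_{j=i+1}^n (1+βx_j)/(x_i−x_j) )`
equals, as an element of `Λ[[β]]` (i.e. coefficientwise in `β`), the coefficient of
`u_1^{−λ_1}⋯u_r^{−λ_r}` in
`∏_i ( (1/(1+βu_i)) ∏_{j=1}^n (1+βx_j) u_i/(u_i−x_j) ) · ∏_{1≤i<j≤r} (u_j ⊖ u_i)/u_j`,
where `u_j ⊖ u_i = (u_j − u_i)/(1 + βu_i)`. -/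
theorem grothendieck_generating_function
    (n r : ℕ) (hr : 1 ≤ r) (hrn : r ≤ n)
    (lam : Fin r → ℕ) (hpos : ∀ i, 0 < lam i)
    (hanti : ∀ i j : Fin r, i ≤ j → lam j ≤ lam i) :
    ∀ d : ℤ,
    (∑ w ∈ Cperm r n,
      (∏ i : Fin r, (CK (x n (w (Fin.castLE hrn i))) : H n r) ^ (lam i + (n - 1 - (i : ℕ)))) *
      (∏ i : Fin r, ∏ j ∈ Finset.Ioi (Fin.castLE hrn i),
          (1 + β n r * CK (x n (w j))) /
          (CK (x n (w (Fin.castLE hrn i))) - CK (x n (w j))))).coeff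
        (eVec r d (fun _ => 0))
    =
    ((∏ i : Fin r,
        ((1 + β n r * u n r i)⁻¹ *
          ∏ j : Fin n, (1 + β n r * CK (x n j)) * u n r i / (u n r i - CK (x n j)))) *
      (∏ i : Fin r, ∏ j ∈ Finset.Ioi i,
          ((u n r j - u n r i) / (1 + β n r * u n r i)) / u n r j)).coeff
        (eVec r d (fun k => (lam k : ℤ))) := by
  intro d
  have hX : Function.Injective fun k => (CK (x n k) : H n r) :=
    HahnSeries.C_injective.comp (x_injective n)
  have hshift : eVec r d (fun _ => 1) =
      eVec r d ((fun k => (lam k : ℤ)) - fun k => ((lam k - 1 : ℕ) : ℤ)) := by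
    congr 1
    funext k
    have := hpos k
    simp only [Pi.sub_apply]
    omega
  rw [← coeff_mul_prod_u_pow _ (fun k => lam k - 1) d (fun k => (lam k : ℤ)), ← hshift,
    generating_function_eq u_ne_zero (fun k => CK (x n k)) (β n r) hrn hpos,
    mul_prod_inv_sub_eq_sum (by omega) hX (fun i j => u_sub_CK_ne_zero i (x n j)),
    HahnSeries.coeff_sum, HahnSeries.coeff_sum,
    sum_congr rfl fun f _ => coeff_numerator_mul_prod_inv (residueWeight_mem_leadingAxis f) _
      (fun i => x n (f i)) d,
    ← sum_Cperm hrn _ fun f hf => ?_]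
  · refine sum_congr rfl fun w _ => congrArg (fun F : H n r => F.coeff (eVec r d fun _ => 0)) ?_
    exact (residueWeight_mul_numerator hrn hX (β n r) (fun k => one_add_β_mul_CK_ne_zero _) _
      w).symm
  · have h : ¬ Function.Injective fun i => (CK (x n (f i)) : H n r) := fun h =>
      hf (h.of_comp (f := fun k => (CK (x n k) : H n r)))
    rw [numerator_eq_zero_of_not_injective _ _ h, mul_zero, HahnSeries.coeff_zero]
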